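/- Let p ∈ (0,1), d ≥ 1, λ ∈ ℤ, let S be a finite index set, and for each T ∈ S fix two distinct indices a_T, b_T ∈ {1, …, d} and a constant c_T ∈ ℤ, such that the map T ↦ {a_T, b_T} is injective on S. Define f : ℤ^d → ℝ by f(w) = ∑_{T ∈ S} h(w_{a_T} + w_{b_T} + c_T). Then the global sensitivity of f equals GS(f) := sup{ |f(w) - f(w')| : w, w' ∈ ℤ^d, ‖w - w'‖₁ ≤ 1 } = (1 + 2p/(1-p)²) · max_{i ∈ {1,…,d}} |{T ∈ S : i ∈ {a_T, b_T}}|. -/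

import Mathlib

open Finset

/-- The debiasing function `h` for the below-threshold indicator:
`h(m) = 0` for `m > λ`, `h(λ) = -p/(1-p)²`, `h(λ-1) = 1 + p/(1-p)²`,
and `h(m) = 1` for `m < λ - 1`. -/
noncomputable def hFun (p : ℝ) (lam : ℤ) (m : ℤ) : ℝ :=
  if lam < m then 0
  else if m = lam then -(p / (1 - p) ^ 2)
  else if m = lam - 1 then 1 + p / (1 - p) ^ 2
  else 1

theorem abs_hFun_sub_hFun_le {p : ℝ} (hp : 0 ≤ p) (lam : ℤ) {m n : ℤ} (hmn : |m - n| ≤ 1) :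
    |hFun p lam m - hFun p lam n| ≤ 1 + 2 * p / (1 - p) ^ 2 := by
  have hq : 0 ≤ p / (1 - p) ^ 2 := by positivity
  rw [mul_div_assoc]
  rw [abs_le] at hmn ⊢
  unfold hFun
  generalize p / (1 - p) ^ 2 = q at hq ⊢
  split_ifs <;> first | omega | (constructor <;> linarith)

theorem hFun_pred_sub_hFun (p : ℝ) (lam : ℤ) :
    hFun p lam (lam - 1) - hFun p lam lam = 1 + 2 * p / (1 - p) ^ 2 := by
  have h₁ : ¬ lam < lam - 1 := by omega
  have h₂ : lam - 1 ≠ lam := by omega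
  simp only [hFun, h₁, h₂, lt_irrefl, if_true, if_false]
  ring

/-- Integer vectors at `ℓ1` distance at most one differ in at most one coordinate. -/
theorem exists_forall_ne_eq_of_sum_abs_sub_le_one {κ : Type*} [Fintype κ] [Nonempty κ]
    {w w' : κ → ℤ} (h : ∑ i, |w i - w' i| ≤ 1) : ∃ i, ∀ j, j ≠ i → w j = w' j := by
  classical
  by_cases hw : ∃ i, w i ≠ w' i
  · obtain ⟨i, hi⟩ := hw
    refine ⟨i, fun j hji => ?_⟩
    by_contra hj
    have hi' : 0 < |w i - w' i| := abs_pos.mpr (sub_ne_zero.mpr hi)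
    have hj' : 0 < |w j - w' j| := abs_pos.mpr (sub_ne_zero.mpr hj)
    have hle : ∑ k ∈ {j, i}, |w k - w' k| ≤ ∑ k, |w k - w' k| :=
      Finset.sum_le_sum_of_subset_of_nonneg (Finset.subset_univ _) fun _ _ _ => abs_nonneg _
    rw [Finset.sum_pair hji] at hle
    omega
  · push Not at hw
    exact ⟨Classical.arbitrary κ, fun j _ => hw j⟩

theorem abs_sum_hFun_sub_sum_hFun_le {p : ℝ} (hp : 0 ≤ p) (lam : ℤ) {ι κ : Type*}
    [Fintype κ] [DecidableEq κ] (S : Finset ι) (a b : ι → κ) (c : ι → ℤ)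
    (hab : ∀ T ∈ S, a T ≠ b T) {w w' : κ → ℤ} (h : ∑ i, |w i - w' i| ≤ 1)
    {i : κ} (hi : ∀ j, j ≠ i → w j = w' j) :
    |(∑ T ∈ S, hFun p lam (w (a T) + w (b T) + c T)) -
        (∑ T ∈ S, hFun p lam (w' (a T) + w' (b T) + c T))| ≤
      (1 + 2 * p / (1 - p) ^ 2) * (S.filter fun T => a T = i ∨ b T = i).card := by
  have hwi : |w i - w' i| ≤ 1 :=
    (Finset.single_le_sum (f := fun k => |w k - w' k|) (fun _ _ => abs_nonneg _)
      (Finset.mem_univ i)).trans h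
  rw [← Finset.sum_sub_distrib, mul_comm, ← nsmul_eq_mul, ← Finset.sum_const,
    Finset.sum_filter]
  refine (Finset.abs_sum_le_sum_abs _ _).trans (Finset.sum_le_sum fun T hT => ?_)
  split_ifs with hTi
  · apply abs_hFun_sub_hFun_le hp
    rcases hTi with ha | hb
    · have := hi (b T) (ha ▸ (hab T hT).symm)
      rw [ha, this]
      convert hwi using 2
      ring
    · have := hi (a T) (hb ▸ hab T hT)
      rw [hb, this]
      convert hwi using 2
      ring
  · push Not at hTi
    rw [hi _ hTi.1, hi _ hTi.2, sub_self, abs_zero]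

/-- If each neighbor of `i` is joined to it by a single `T ∈ S`, some vector vanishing at `i`
puts every `T ∈ S` incident to `i` at the prescribed level. -/
theorem exists_forall_incident_add_eq {ι κ : Type*} [DecidableEq κ] (S : Finset ι)
    (a b : ι → κ) (c : ι → ℤ) (hab : ∀ T ∈ S, a T ≠ b T)
    (hinj : Set.InjOn (fun T => ({a T, b T} : Finset κ)) S) (i : κ) (m : ℤ) :
    ∃ w : κ → ℤ, w i = 0 ∧ ∀ T ∈ S, a T = i ∨ b T = i → w (a T) + w (b T) + c T = m := by
  classical
  let P : κ → ι → Prop := fun j T => T ∈ S ∧ ({a T, b T} : Finset κ) = {i, j}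
  let w : κ → ℤ := fun j =>
    if h : j ≠ i ∧ ∃ T, P j T then m - c h.2.choose else 0
  have hwi : w i = 0 := dif_neg fun h => h.1 rfl
  have hw : ∀ j T, j ≠ i → P j T → w j = m - c T := by
    intro j T hj hT
    have h : j ≠ i ∧ ∃ T, P j T := ⟨hj, T, hT⟩
    have hc := h.2.choose_spec
    have heq : h.2.choose = T := hinj hc.1 hT.1 (hc.2.trans hT.2.symm)
    simp only [w, dif_pos h, heq]
  refine ⟨w, hwi, fun T hT hTi => ?_⟩
  rcases hTi with ha | hb
  · have := hw (b T) T (ha ▸ (hab T hT).symm) ⟨hT, by rw [ha]⟩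
    rw [ha, hwi, this]
    ring
  · have := hw (a T) T (hb ▸ hab T hT) ⟨hT, by rw [hb, Finset.pair_comm]⟩
    rw [hb, hwi, this]
    ring

theorem sum_hFun_sub_sum_hFun_update (p : ℝ) (lam : ℤ) {ι κ : Type*} [DecidableEq κ]
    (S : Finset ι) (a b : ι → κ) (c : ι → ℤ) (hab : ∀ T ∈ S, a T ≠ b T) {w : κ → ℤ} {i : κ}
    (hwi : w i = 0)
    (hw : ∀ T ∈ S, a T = i ∨ b T = i → w (a T) + w (b T) + c T = lam - 1) :
    (∑ T ∈ S, hFun p lam (w (a T) + w (b T) + c T)) -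
        (∑ T ∈ S, hFun p lam
          (Function.update w i 1 (a T) + Function.update w i 1 (b T) + c T)) =
      (1 + 2 * p / (1 - p) ^ 2) * (S.filter fun T => a T = i ∨ b T = i).card := by
  rw [← Finset.sum_sub_distrib, mul_comm, ← nsmul_eq_mul, ← Finset.sum_const,
    Finset.sum_filter]
  refine Finset.sum_congr rfl fun T hT => ?_
  split_ifs with hTi
  · have hlam : Function.update w i 1 (a T) + Function.update w i 1 (b T) + c T = lam := by
      have hm := hw T hT hTi
      rcases hTi with ha | hb
      · have hb : b T ≠ i := ha ▸ (hab T hT).symm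
        rw [ha, hwi] at hm
        rw [ha, Function.update_self, Function.update_of_ne hb]
        omega
      · have ha : a T ≠ i := hb ▸ hab T hT
        rw [hb, hwi] at hm
        rw [hb, Function.update_self, Function.update_of_ne ha]
        omega
    rw [hw T hT hTi, hlam, hFun_pred_sub_hFun]
  · push Not at hTi
    rw [Function.update_of_ne hTi.1, Function.update_of_ne hTi.2, sub_self]

/-- The global sensitivity of the local below-threshold count (unbiased estimator)
equals `(1 + 2p/(1-p)²)` times the maximum number of counted triangles sharing a
single incident edge. -/
theorem global_sensitivity_unbiased_count
    (p : ℝ) (hp : p ∈ Set.Ioo (0 : ℝ) 1)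
    (d : ℕ) (hd : 1 ≤ d) (lam : ℤ) {ι : Type*} (S : Finset ι)
    (a b : ι → Fin d) (c : ι → ℤ)
    (hab : ∀ T ∈ S, a T ≠ b T)
    (hinj : Set.InjOn (fun T => ({a T, b T} : Finset (Fin d))) S) :
    sSup {x : ℝ | ∃ w w' : Fin d → ℤ, (∑ i, |w i - w' i|) ≤ 1 ∧
        x = |(∑ T ∈ S, hFun p lam (w (a T) + w (b T) + c T)) -
             (∑ T ∈ S, hFun p lam (w' (a T) + w' (b T) + c T))|} =
      (1 + 2 * p / (1 - p) ^ 2) *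
        ((Finset.univ.sup fun i : Fin d =>
          (S.filter fun T => a T = i ∨ b T = i).card) : ℕ) := by
  have : NeZero d := ⟨by omega⟩
  have hK : 0 ≤ 1 + 2 * p / (1 - p) ^ 2 := by
    have := hp.1
    positivity
  apply IsGreatest.csSup_eq
  constructor
  · obtain ⟨i, -, hi⟩ := Finset.exists_mem_eq_sup Finset.univ Finset.univ_nonempty
      fun i : Fin d => (S.filter fun T => a T = i ∨ b T = i).card
    obtain ⟨w, hwi, hw⟩ := exists_forall_incident_add_eq S a b c hab hinj i (lam - 1)
    refine ⟨w, Function.update w i 1, ?_, ?_⟩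
    · rw [Finset.sum_eq_single i (fun j _ hj => by simp [Function.update_of_ne hj]) (by simp)]
      simp [hwi]
    · rw [sum_hFun_sub_sum_hFun_update p lam S a b c hab hwi hw, hi,
        abs_of_nonneg (mul_nonneg hK (Nat.cast_nonneg _))]
  · rintro x ⟨w, w', h, rfl⟩
    obtain ⟨i, hi⟩ := exists_forall_ne_eq_of_sum_abs_sub_le_one h
    refine (abs_sum_hFun_sub_sum_hFun_le hp.1.le lam S a b c hab h hi).trans ?_
    refine mul_le_mul_of_nonneg_left (Nat.cast_le.mpr ?_) hK
    exact Finset.le_sup (f := fun i : Fin d => (S.filter fun T => a T = i ∨ b T = i).card)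
      (Finset.mem_univ i)
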